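/- Let p ≥ 1. For every κ > 0 there exist constants C > 0 and σ > 0, depending only on A, k, m, n, p and κ, such that for every global weak solution u of the problem and every R > 0 with mes{(x,t) ∈ Q_R^κ : u(x,t) ≠ 0} > 0, one has F_κ( ( σ R^{−(n+κ)} ∫_{Q_R^κ} |u|^p dx dt )^{1/p} ) ≥ C R, where F_κ(s) = ( ∫_s^∞ ζ^{1/k−1} f(ζ)^{−1/k} dζ )^{1/κ} + ∫_s^∞ ζ^{p/m−1} f(ζ)^{−1/m} dζ. -/

import Mathlib

open MeasureTheory Real Set Filter

noncomputable section

/-- The spatial domain `ℝⁿ`. -/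
abbrev Spc (n : ℕ) := EuclideanSpace ℝ (Fin n)

/-- The open ball `B_r` in `ℝⁿ` of radius `r` centered at `0`. -/
def ball0 (n : ℕ) (r : ℝ) : Set (Spc n) := Metric.ball 0 r

/-- The cylinder `Q_r^κ = B_r × (0, r^κ)`. -/
def cyl (n : ℕ) (r κ : ℝ) : Set (Spc n × ℝ) := ball0 n r ×ˢ Ioo 0 (r ^ κ)

/-- The half-space `ℝ^{n+1}_+ = ℝⁿ × (0, ∞)`. -/
def halfSp (n : ℕ) : Set (Spc n × ℝ) := {z | 0 < z.2}

/-- The (finite) set of multi-indices `α` with `|α| = m`. -/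
def mIdx (n m : ℕ) : Finset (Fin n → ℕ) :=
  (Fintype.piFinset fun _ : Fin n => Finset.range (m + 1)).filter fun α => ∑ i, α i = m

/-- Spatial partial derivative `∂/∂x_i`. -/
def spDeriv (n : ℕ) (i : Fin n) (φ : Spc n × ℝ → ℝ) : Spc n × ℝ → ℝ :=
  fun z => deriv (fun s : ℝ => φ (z.1 + s • EuclideanSpace.single i (1 : ℝ), z.2)) 0

/-- Time derivative `∂/∂t`. -/
def tDeriv (n : ℕ) (φ : Spc n × ℝ → ℝ) : Spc n × ℝ → ℝ :=
  fun z => deriv (fun s : ℝ => φ (z.1, s)) z.2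

/-- Multi-index spatial derivative `∂^α`. -/
def mDeriv (n : ℕ) (α : Fin n → ℕ) (φ : Spc n × ℝ → ℝ) : Spc n × ℝ → ℝ :=
  (List.finRange n).foldr (fun i ψ => (spDeriv n i)^[α i] ψ) φ

/-- Caratheodory conditions and the growth bound `|a_α(x,t,ζ)| ≤ A |ζ|^p` for the
coefficients of the operator `L`. -/
def GoodCoeffs (n m : ℕ) (A p : ℝ) (a : (Fin n → ℕ) → Spc n × ℝ → ℝ → ℝ) : Prop :=
  ∀ α ∈ mIdx n m,
    (∀ ζ : ℝ, Measurable fun z => a α z ζ) ∧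
    (∀ᵐ z ∂(volume.restrict (halfSp n)), Continuous fun ζ => a α z ζ) ∧
    (∀ᵐ z ∂(volume.restrict (halfSp n)), ∀ ζ : ℝ, |a α z ζ| ≤ A * |ζ| ^ p)

/-- The standing conditions on `f`: `ζ ↦ f ζ` and `ζ ↦ f (ζ^{1/p})` are nondecreasing
and convex on `[0,∞)`, and `f` is positive on `(0,∞)`. -/
def GoodF (p : ℝ) (f : ℝ → ℝ) : Prop :=
  MonotoneOn f (Ici 0) ∧ ConvexOn ℝ (Ici 0) f ∧
  MonotoneOn (fun ζ => f (ζ ^ (1 / p))) (Ici 0) ∧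
  ConvexOn ℝ (Ici 0) (fun ζ => f (ζ ^ (1 / p))) ∧
  ∀ ζ : ℝ, 0 < ζ → 0 < f ζ

/-- Condition (1.4): `∫_1^∞ ζ^{1/k - 1} f(ζ)^{-1/k} dζ < ∞`. -/
def Cond14 (k : ℕ) (f : ℝ → ℝ) : Prop :=
  IntegrableOn (fun ζ : ℝ => ζ ^ ((k : ℝ)⁻¹ - 1) / f ζ ^ ((k : ℝ)⁻¹)) (Ioi 1)

/-- Condition (1.5): `∫_1^∞ ζ^{p/m - 1} f(ζ)^{-1/m} dζ < ∞`. -/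
def Cond15 (m : ℕ) (p : ℝ) (f : ℝ → ℝ) : Prop :=
  IntegrableOn (fun ζ : ℝ => ζ ^ (p / (m : ℝ) - 1) / f ζ ^ ((m : ℝ)⁻¹)) (Ioi 1)

/-- `v ∈ L^1_loc(ℝⁿ)`. -/
def L1locInit (n : ℕ) (v : Spc n → ℝ) : Prop :=
  ∀ r : ℝ, 0 < r → IntegrableOn v (ball0 n r)

/-- `u` is a global weak solution of
`∂_t^k u - Σ_{|α| = m} ∂^α a_α(x,t,u) ≥ f(|u|)` in `ℝ^{n+1}_+`, with initial data
`∂_t^i u(·,0) = u0 i` for `0 ≤ i ≤ k-1`. -/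
def IsGlobalWeakSol (n k m : ℕ) (p : ℝ) (a : (Fin n → ℕ) → Spc n × ℝ → ℝ → ℝ)
    (f : ℝ → ℝ) (u0 : ℕ → Spc n → ℝ) (u : Spc n × ℝ → ℝ) : Prop :=
  (∀ r : ℝ, 0 < r → IntegrableOn u (cyl n r 1)) ∧
  (∀ r : ℝ, 0 < r → IntegrableOn (fun z => |u z| ^ p) (cyl n r 1)) ∧
  (∀ r : ℝ, 0 < r → IntegrableOn (fun z => f |u z|) (cyl n r 1)) ∧
  ∀ φ : Spc n × ℝ → ℝ, ContDiff ℝ (⊤ : ℕ∞) φ → HasCompactSupport φ →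
    (∀ z, 0 ≤ φ z) →
    (∫ z in halfSp n, (-1 : ℝ) ^ k * u z * (tDeriv n)^[k] φ z)
      - (∫ z in halfSp n, ∑ α ∈ mIdx n m, (-1 : ℝ) ^ m * a α z (u z) * mDeriv n α φ z)
    ≥ (∫ x : Spc n, ∑ i ∈ Finset.range k,
          (-1 : ℝ) ^ i * u0 (k - 1 - i) x * (tDeriv n)^[i] φ (x, 0))
      + ∫ z in halfSp n, f |u z| * φ z

/-- `u = 0` almost everywhere in `ℝ^{n+1}_+`. -/
def TrivialSol (n : ℕ) (u : Spc n × ℝ → ℝ) : Prop :=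
  ∀ᵐ z ∂(volume.restrict (halfSp n)), u z = 0

/-- The standing hypotheses of Section 3: the coefficients are Caratheodory functions
with the growth bound, `f` satisfies the monotonicity/convexity/positivity conditions
together with (1.4) and (1.5), and the initial data are locally integrable with
`u_{k-1} ≥ 0` a.e. -/
def Standing (n k m : ℕ) (A p : ℝ) (a : (Fin n → ℕ) → Spc n × ℝ → ℝ → ℝ)
    (f : ℝ → ℝ) (u0 : ℕ → Spc n → ℝ) : Prop :=
  GoodCoeffs n m A p a ∧ GoodF p f ∧
  (∀ i < k, L1locInit n (u0 i)) ∧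
  (∀ᵐ x ∂(volume : Measure (Spc n)), 0 ≤ u0 (k - 1) x) ∧
  Cond14 k f ∧ Cond15 m p f

/-- The function `F_κ(s) = (∫_s^∞ ζ^{1/k-1} f(ζ)^{-1/k} dζ)^{1/κ}
  + ∫_s^∞ ζ^{p/m-1} f(ζ)^{-1/m} dζ`. -/
def Fkappa (k m : ℕ) (p κ : ℝ) (f : ℝ → ℝ) (s : ℝ) : ℝ :=
  (∫ ζ in Ioi s, ζ ^ ((k : ℝ)⁻¹ - 1) / f ζ ^ ((k : ℝ)⁻¹)) ^ κ⁻¹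
    + ∫ ζ in Ioi s, ζ ^ (p / (m : ℝ) - 1) / f ζ ^ ((m : ℝ)⁻¹)

/-- A smooth step on `ℝ`: equal to `1` left of `1/3` and to `0` right of `2/3`. -/
def smoothStep (s : ℝ) : ℝ := smoothTransition (2 - 3 * s)

lemma contDiff_smoothStep : ContDiff ℝ (⊤ : ℕ∞) smoothStep :=
  smoothTransition.contDiff.comp (contDiff_const.sub (contDiff_const.mul contDiff_id))

lemma smoothStep_eq_one {s : ℝ} (h : s ≤ 1 / 3) : smoothStep s = 1 :=
  smoothTransition.one_of_one_le (by linarith)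

lemma smoothStep_eq_zero {s : ℝ} (h : 2 / 3 ≤ s) : smoothStep s = 0 :=
  smoothTransition.zero_of_nonpos (by linarith)

lemma exists_bound_iteratedFDeriv_smoothStep (j : ℕ) :
    ∃ C, 1 ≤ C ∧ ∀ i ≤ j, ∀ s ∈ Icc (0 : ℝ) 1, ‖iteratedFDeriv ℝ i smoothStep s‖ ≤ C := by
  have hb : ∀ i : ℕ, ∃ C, ∀ s ∈ Icc (0 : ℝ) 1, ‖iteratedFDeriv ℝ i smoothStep s‖ ≤ C := fun i =>
    isCompact_Icc.exists_bound_of_continuousOn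
      (contDiff_smoothStep.continuous_iteratedFDeriv (by exact_mod_cast le_top)).continuousOn
  choose C hC using hb
  refine ⟨1 + ∑ i ∈ Finset.range (j + 1), |C i|, ?_, fun i hi s hs => ?_⟩
  · linarith [Finset.sum_nonneg (fun i (_ : i ∈ Finset.range (j + 1)) => abs_nonneg (C i))]
  · have := Finset.single_le_sum (f := fun i => |C i|) (fun i _ => abs_nonneg _)
      (Finset.mem_range.2 (Nat.lt_succ_of_le hi))
    linarith [hC i s hs, le_abs_self (C i)]

section QuadRamp

variable {E : Type*} [NormedAddCommGroup E] [InnerProductSpace ℝ E]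

/-- The quadratic function interpolating between `0` on the sphere of radius `a` and `1` on the
sphere of radius `b`. -/
def quadRamp (a b : ℝ) (x : E) : ℝ := (‖x‖ ^ 2 - a ^ 2) / (b ^ 2 - a ^ 2)

lemma contDiff_quadRamp (a b : ℝ) : ContDiff ℝ (⊤ : ℕ∞) (quadRamp a b : E → ℝ) :=
  ((contDiff_norm_sq ℝ).sub contDiff_const).div_const _

lemma fderiv_quadRamp (a b : ℝ) :
    fderiv ℝ (quadRamp a b : E → ℝ) = ⇑((2 / (b ^ 2 - a ^ 2)) • innerSL ℝ (E := E)) := by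
  ext1 x
  have h : HasFDerivAt (fun x : E => ‖x‖ ^ 2) (2 • innerSL ℝ x) x := by
    have := ((contDiff_norm_sq ℝ (E := E) (n := 1)).differentiable one_ne_zero x).hasFDerivAt
    rwa [fderiv_norm_sq_apply] at this
  have h2 := (h.sub_const (a ^ 2)).mul_const (b ^ 2 - a ^ 2)⁻¹
  have h3 : HasFDerivAt (quadRamp a b : E → ℝ) ((b ^ 2 - a ^ 2)⁻¹ • (2 • innerSL ℝ x)) x := by
    rwa [show (quadRamp a b : E → ℝ) = fun x => (‖x‖ ^ 2 - a ^ 2) * (b ^ 2 - a ^ 2)⁻¹ from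
      funext fun _ => div_eq_mul_inv _ _]
  rw [h3.fderiv]
  ext y
  simp [div_eq_mul_inv]
  ring

lemma norm_iteratedFDeriv_quadRamp_le {a b : ℝ} (ha : 0 < a) (hab : a < b) {x : E}
    (hx : ‖x‖ ≤ b) {i : ℕ} (hi : 1 ≤ i) :
    ‖iteratedFDeriv ℝ i (quadRamp a b : E → ℝ) x‖ ≤ (2 / (b - a)) ^ i := by
  have hba : 0 < b - a := sub_pos.2 hab
  have hsq : 0 < b ^ 2 - a ^ 2 := by nlinarith
  set L : E →L[ℝ] E →L[ℝ] ℝ := (2 / (b ^ 2 - a ^ 2)) • innerSL ℝ (E := E) with hL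
  have hLx : ∀ y, ‖L y‖ ≤ 2 / (b ^ 2 - a ^ 2) * ‖y‖ := fun y => by
    simp only [hL, smul_apply, norm_smul]
    rw [Real.norm_of_nonneg (by positivity)]
    exact mul_le_mul_of_nonneg_left (innerSL_apply_norm (𝕜 := ℝ) y).le (by positivity)
  obtain ⟨i, rfl⟩ : ∃ l, i = l + 1 := ⟨i - 1, by omega⟩
  rw [← norm_iteratedFDeriv_fderiv, fderiv_quadRamp, ← hL]
  rcases i with _ | i
  · rw [norm_iteratedFDeriv_zero, zero_add, pow_one]
    refine (hLx x).trans ?_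
    rw [div_mul_eq_mul_div, div_le_div_iff₀ hsq hba]
    nlinarith [mul_le_mul_of_nonneg_right hx hba.le]
  · rw [← norm_iteratedFDeriv_fderiv]
    have hf : fderiv ℝ (⇑L) = fun _ => L := by ext1 y; exact L.fderiv
    rw [hf]
    rcases i with _ | i
    · rw [norm_iteratedFDeriv_zero]
      refine (L.opNorm_le_bound (by positivity) hLx).trans ?_
      rw [div_pow, div_le_div_iff₀ hsq (by positivity), zero_add, one_add_one_eq_two]
      nlinarith [mul_pos ha hba, sq_nonneg (b - a)]
    · rw [iteratedFDeriv_succ_const]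
      simp only [Pi.zero_apply, norm_zero]
      positivity

end QuadRamp

/-- Smooth radial cutoff functions between two concentric balls, with derivatives controlled by
powers of the gap between the radii, uniformly in the radii. -/
theorem exists_radial_cutoff (E : Type*) [NormedAddCommGroup E] [InnerProductSpace ℝ E]
    [FiniteDimensional ℝ E] :
    ∃ c : ℕ → ℝ, (∀ j, 0 < c j) ∧ ∀ a b : ℝ, 0 < a → a < b → ∃ g : E → ℝ,
      ContDiff ℝ (⊤ : ℕ∞) g ∧ HasCompactSupport g ∧ (∀ x, 0 ≤ g x) ∧
      (∀ x, ‖x‖ < a → g x = 1) ∧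
      (∀ j x, ‖iteratedFDeriv ℝ j g x‖ ≤ c j / (b - a) ^ j) ∧
      ∀ j x, b ≤ ‖x‖ → iteratedFDeriv ℝ j g x = 0 := by
  choose C hC1 hC using exists_bound_iteratedFDeriv_smoothStep
  have hCpos : ∀ j, 0 < C j := fun j => one_pos.trans_le (hC1 j)
  refine ⟨fun j => (Nat.factorial j : ℝ) * C j * 2 ^ j, fun j => ?_, fun a b ha hab => ?_⟩
  · have := hCpos j
    positivity
  have hba : 0 < b - a := sub_pos.2 hab
  have hsq : 0 < b ^ 2 - a ^ 2 := by nlinarith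
  have hqc : Continuous (quadRamp a b : E → ℝ) := (contDiff_quadRamp a b).continuous
  have hge : ∀ x : E, b ≤ ‖x‖ → 1 ≤ quadRamp a b x := fun x hx => by
    rw [quadRamp, le_div_iff₀ hsq]
    nlinarith
  have hle : ∀ x : E, ‖x‖ < a → quadRamp a b x ≤ 0 := fun x hx =>
    div_nonpos_of_nonpos_of_nonneg (by nlinarith [norm_nonneg x]) hsq.le
  have hzero : ∀ x : E, 2 / 3 < quadRamp a b x →
      (smoothStep ∘ quadRamp a b : E → ℝ) =ᶠ[nhds x] fun _ => 0 := fun x hx => by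
    filter_upwards [hqc.continuousAt.eventually (lt_mem_nhds hx)] with y hy
    exact smoothStep_eq_zero hy.le
  have hone : ∀ x : E, quadRamp a b x < 1 / 3 →
      (smoothStep ∘ quadRamp a b : E → ℝ) =ᶠ[nhds x] fun _ => 1 := fun x hx => by
    filter_upwards [hqc.continuousAt.eventually (gt_mem_nhds hx)] with y hy
    exact smoothStep_eq_one hy.le
  have hvan : ∀ j (x : E), 2 / 3 < quadRamp a b x →
      iteratedFDeriv ℝ j (smoothStep ∘ quadRamp a b : E → ℝ) x = 0 := fun j x hx => by
    rw [((hzero x hx).iteratedFDeriv ℝ j).eq_of_nhds]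
    simp
  refine ⟨smoothStep ∘ quadRamp a b, contDiff_smoothStep.comp (contDiff_quadRamp a b), ?_,
    fun x => smoothTransition.nonneg _,
    fun x hx => smoothStep_eq_one ((hle x hx).trans (by norm_num)), fun j x => ?_,
    fun j x hx => hvan j x (by linarith [hge x hx])⟩
  · refine HasCompactSupport.intro (isCompact_closedBall (0 : E) b) fun x hx => ?_
    rw [mem_closedBall_zero_iff, not_le] at hx
    exact smoothStep_eq_zero (by linarith [hge x hx.le])
  · have := hCpos j
    have hpos : 0 ≤ (Nat.factorial j : ℝ) * C j * 2 ^ j / (b - a) ^ j := by positivity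
    rcases lt_or_ge (2 / 3) (quadRamp a b x) with h | h
    · rwa [hvan j x h, norm_zero]
    rcases lt_or_ge (quadRamp a b x) 0 with h' | h'
    · rw [((hone x (by linarith)).iteratedFDeriv ℝ j).eq_of_nhds]
      rcases j with _ | j
      · rw [norm_iteratedFDeriv_zero]
        simpa using hC1 0
      · rwa [iteratedFDeriv_succ_const, Pi.zero_apply, norm_zero]
    · have hxb : ‖x‖ ≤ b := by
        by_contra! hlt
        linarith [hge x hlt.le]
      refine (norm_iteratedFDeriv_comp_le contDiff_smoothStep (contDiff_quadRamp a b)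
        (by exact_mod_cast le_top) x (fun i hi => hC j i hi _ ⟨h', by linarith⟩)
        (fun i hi _ => norm_iteratedFDeriv_quadRamp_le ha hab hxb hi)).trans_eq ?_
      rw [div_pow, mul_div_assoc]

/-- The weight `ζ ^ (e - 1) / f ζ ^ b` whose tail integrals enter `Fkappa`. -/
def tailWeight (f : ℝ → ℝ) (e b : ℝ) (ζ : ℝ) : ℝ := ζ ^ (e - 1) / f ζ ^ b

section TailWeight

variable {f : ℝ → ℝ} {e b : ℝ}

lemma tailWeight_nonneg (hpos : ∀ ζ, 0 < ζ → 0 < f ζ) {ζ : ℝ} (hζ : 0 < ζ) :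
    0 ≤ tailWeight f e b ζ :=
  div_nonneg (rpow_nonneg hζ.le _) (rpow_nonneg (hpos ζ hζ).le _)

lemma integrableOn_tailWeight_Ioi (hmono : MonotoneOn f (Ici 0)) (hpos : ∀ ζ, 0 < ζ → 0 < f ζ)
    (hb : 0 ≤ b) (hint : IntegrableOn (tailWeight f e b) (Ioi 1)) {s : ℝ} (hs : 0 < s) :
    IntegrableOn (tailWeight f e b) (Ioi s) := by
  have hcpt : IntegrableOn (tailWeight f e b) (Icc s 1) := by
    have hanti : AntitoneOn (fun ζ => (f ζ ^ b)⁻¹) (Icc s 1) := fun x hx y hy hxy => by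
      have hx0 : 0 < x := hs.trans_le hx.1
      have hy0 : 0 < y := hs.trans_le hy.1
      exact inv_anti₀ (rpow_pos_of_pos (hpos x hx0) _)
        (rpow_le_rpow (hpos x hx0).le (hmono hx0.le hy0.le hxy) hb)
    have hcont : ContinuousOn (fun ζ : ℝ => ζ ^ (e - 1)) (Icc s 1) := fun x hx =>
      (continuousAt_rpow_const x _ (Or.inl (hs.trans_le hx.1).ne')).continuousWithinAt
    have := IntegrableOn.continuousOn_mul hcont (hanti.integrableOn_isCompact (μ := volume) isCompact_Icc)
      isCompact_Icc
    exact this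
  refine (hcpt.union hint).mono_set fun x hx => ?_
  rcases le_or_gt x 1 with h | h
  · exact Or.inl ⟨(mem_Ioi.1 hx).le, h⟩
  · exact Or.inr h

lemma le_setIntegral_tailWeight (hmono : MonotoneOn f (Ici 0)) (hpos : ∀ ζ, 0 < ζ → 0 < f ζ)
    (he : 0 ≤ e) (hb : 0 ≤ b) {y : ℝ} (hy : 0 < y)
    (hint : IntegrableOn (tailWeight f e b) (Ioi (y / 2))) :
    y ^ e / f y ^ b ≤ 2 ^ (e + 1) *
      ((∫ ζ in Ioi (y / 2), tailWeight f e b ζ) - ∫ ζ in Ioi y, tailWeight f e b ζ) := by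
  have hsub : Ioi (y / 2) = Ioc (y / 2) y ∪ Ioi y := (Ioc_union_Ioi_eq_Ioi (by linarith)).symm
  have h1 : IntegrableOn (tailWeight f e b) (Ioc (y / 2) y) := hint.mono_set Ioc_subset_Ioi_self
  have h2 : IntegrableOn (tailWeight f e b) (Ioi y) :=
    hint.mono_set (Ioi_subset_Ioi (by linarith))
  rw [hsub, setIntegral_union (Ioc_disjoint_Ioi le_rfl) measurableSet_Ioi h1 h2, add_sub_cancel_right]
  have hlow : ∀ ζ ∈ Ioc (y / 2) y,
      (y / 2) ^ e / y / f y ^ b ≤ tailWeight f e b ζ := fun ζ hζ => by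
    have hζ0 : 0 < ζ := (half_pos hy).trans hζ.1
    rw [tailWeight, rpow_sub_one hζ0.ne']
    have := hpos ζ hζ0
    have hle := hmono hζ0.le hy.le hζ.2
    have := rpow_le_rpow (half_pos hy).le hζ.1.le he
    gcongr
    exact hζ.2
  have hconst : IntegrableOn (fun _ : ℝ => (y / 2) ^ e / y / f y ^ b) (Ioc (y / 2) y) := by
    simp
  have := setIntegral_mono_on hconst h1 measurableSet_Ioc hlow
  rw [setIntegral_const, Real.volume_real_Ioc_of_le (by linarith), smul_eq_mul] at this
  refine le_trans (le_of_eq ?_) (mul_le_mul_of_nonneg_left this (by positivity))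
  rw [div_rpow hy.le zero_le_two, rpow_add_one two_ne_zero]
  have : (2 : ℝ) ^ e ≠ 0 := by positivity
  have := (rpow_pos_of_pos (hpos y hy) b).ne'
  field_simp
  ring

end TailWeight

lemma length_le_of_growth_step {K P Q v δ : ℝ} {k : ℕ} (hk : k ≠ 0) (hK : 0 < K) (hP : 0 < P)
    (hv : 0 < v) (hδ : 0 < δ) (h : v ≤ K * (P / δ ^ k)) (hQ : P ^ ((k : ℝ)⁻¹) ≤ Q) :
    δ ≤ K ^ ((k : ℝ)⁻¹) * (Q / v ^ ((k : ℝ)⁻¹)) := by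
  have h1 : δ ^ k ≤ K * (P / v) := by
    rw [← mul_div_assoc, le_div_iff₀ (by positivity)] at h
    rw [← mul_div_assoc, le_div_iff₀ hv]
    linarith
  have hk0 : (0 : ℝ) ≤ (k : ℝ)⁻¹ := by positivity
  calc δ = (δ ^ k) ^ ((k : ℝ)⁻¹) := (pow_rpow_inv_natCast hδ.le hk).symm
    _ ≤ (K * (P / v)) ^ ((k : ℝ)⁻¹) := rpow_le_rpow (by positivity) h1 hk0
    _ = K ^ ((k : ℝ)⁻¹) * (P ^ ((k : ℝ)⁻¹) / v ^ ((k : ℝ)⁻¹)) := by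
      rw [mul_rpow hK.le (by positivity), div_rpow hP.le hv.le]
    _ ≤ _ := by gcongr

/-- Doubling argument: a function on `[r₀, r₁]` whose growth is controlled from below in terms of
`f` can double only while spending the tail integrals of `f`. -/
theorem length_le_tail_integrals {f y : ℝ → ℝ} {k m : ℕ} {p K B r₀ r₁ : ℝ}
    (hk : k ≠ 0) (hm : m ≠ 0) (hp : 0 < p) (hK : 0 < K) (hB : 0 < B)
    (hmono : MonotoneOn f (Ici 0)) (hpos : ∀ ζ, 0 < ζ → 0 < f ζ)
    (h14 : IntegrableOn (tailWeight f (k : ℝ)⁻¹ (k : ℝ)⁻¹) (Ioi 1))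
    (h15 : IntegrableOn (tailWeight f (p / m) (m : ℝ)⁻¹) (Ioi 1))
    (h01 : r₀ ≤ r₁) (hy : MonotoneOn y (Icc r₀ r₁)) (hy0 : 0 < y r₀)
    (hgrow : ∀ r s, r₀ ≤ r → r < s → s ≤ r₁ →
      f (y r) ≤ K * (y s / (B * (s - r)) ^ k + y s ^ p / (s - r) ^ m)) :
    r₁ - r₀ ≤ (4 * K) ^ ((k : ℝ)⁻¹) * 2 ^ ((k : ℝ)⁻¹ + 1) / B *
        (∫ ζ in Ioi (y r₀ / 2), tailWeight f (k : ℝ)⁻¹ (k : ℝ)⁻¹ ζ)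
      + (2 * 2 ^ p * K) ^ ((m : ℝ)⁻¹) * 2 ^ (p / m + 1) *
        ∫ ζ in Ioi (y r₀ / 2), tailWeight f (p / m) (m : ℝ)⁻¹ ζ := by
  set c₁ := (4 * K) ^ ((k : ℝ)⁻¹) * 2 ^ ((k : ℝ)⁻¹ + 1) / B with hc₁
  set c₂ := (2 * 2 ^ p * K) ^ ((m : ℝ)⁻¹) * 2 ^ (p / m + 1) with hc₂
  have hc₁0 : 0 ≤ c₁ := by positivity
  have hc₂0 : 0 ≤ c₂ := by positivity
  set T : ℝ → ℝ := fun s => c₁ * (∫ ζ in Ioi s, tailWeight f (k : ℝ)⁻¹ (k : ℝ)⁻¹ ζ)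
    + c₂ * ∫ ζ in Ioi s, tailWeight f (p / m) (m : ℝ)⁻¹ ζ with hT
  have hi1 : ∀ s, 0 < s → IntegrableOn (tailWeight f (k : ℝ)⁻¹ (k : ℝ)⁻¹) (Ioi s) := fun s hs =>
    integrableOn_tailWeight_Ioi hmono hpos (by positivity) h14 hs
  have hi2 : ∀ s, 0 < s → IntegrableOn (tailWeight f (p / m) (m : ℝ)⁻¹) (Ioi s) := fun s hs =>
    integrableOn_tailWeight_Ioi hmono hpos (by positivity) h15 hs
  have hTanti : ∀ s t, 0 < s → s ≤ t → T t ≤ T s := fun s t hs hst => by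
    have hnn : ∀ e b, 0 ≤ᵐ[volume.restrict (Ioi s)] tailWeight f e b := fun e b =>
      (ae_restrict_iff' measurableSet_Ioi).2 (.of_forall fun ζ hζ =>
        tailWeight_nonneg hpos (hs.trans hζ))
    have hsub : (Ioi t : Set ℝ) ≤ᵐ[volume] Ioi s := (Ioi_subset_Ioi hst).eventuallyLE
    exact add_le_add
      (mul_le_mul_of_nonneg_left (setIntegral_mono_set (hi1 s hs) (hnn _ _) hsub) hc₁0)
      (mul_le_mul_of_nonneg_left (setIntegral_mono_set (hi2 s hs) (hnn _ _) hsub) hc₂0)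
  have hTnn : ∀ s, 0 < s → 0 ≤ T s := fun s hs =>
    add_nonneg
      (mul_nonneg hc₁0 (setIntegral_nonneg measurableSet_Ioi fun ζ hζ =>
        tailWeight_nonneg hpos (hs.trans hζ)))
      (mul_nonneg hc₂0 (setIntegral_nonneg measurableSet_Ioi fun ζ hζ =>
        tailWeight_nonneg hpos (hs.trans hζ)))
  have hypos : ∀ r, r₀ ≤ r → r ≤ r₁ → 0 < y r := fun r h h' =>
    hy0.trans_le (hy ⟨le_rfl, h01⟩ ⟨h, h'⟩ h)
  have hstep : ∀ r s, r₀ ≤ r → r < s → s ≤ r₁ → y s ≤ 2 * y r →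
      s - r ≤ T (y r / 2) - T (y r) := fun r s hr hrs hs hys => by
    have hyr := hypos r hr (hrs.le.trans hs)
    have hysp := hypos s (hr.trans hrs.le) hs
    have hf := hpos _ hyr
    have hδ : 0 < s - r := sub_pos.2 hrs
    have hw1 := le_setIntegral_tailWeight (e := (k : ℝ)⁻¹) (b := (k : ℝ)⁻¹) hmono hpos
      (by positivity) (by positivity) hyr (hi1 _ (half_pos hyr))
    have hw2 := le_setIntegral_tailWeight (e := p / m) (b := (m : ℝ)⁻¹) hmono hpos
      (by positivity) (by positivity) hyr (hi2 _ (half_pos hyr))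
    have hw1' : 0 ≤ y r ^ ((k : ℝ)⁻¹) / f (y r) ^ ((k : ℝ)⁻¹) := by positivity
    have hw2' : 0 ≤ y r ^ (p / m) / f (y r) ^ ((m : ℝ)⁻¹) := by positivity
    have hys' : y s ^ p ≤ 2 ^ p * y r ^ p := by
      rw [← mul_rpow zero_le_two hyr.le]
      exact rpow_le_rpow hysp.le hys hp.le
    have hg : f (y r) ≤ K * (2 * y r / (B * (s - r)) ^ k + 2 ^ p * y r ^ p / (s - r) ^ m) :=
      (hgrow r s hr hrs hs).trans (by gcongr)
    set D₁ := (∫ ζ in Ioi (y r / 2), tailWeight f (k : ℝ)⁻¹ (k : ℝ)⁻¹ ζ)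
      - ∫ ζ in Ioi (y r), tailWeight f (k : ℝ)⁻¹ (k : ℝ)⁻¹ ζ with hD₁
    set D₂ := (∫ ζ in Ioi (y r / 2), tailWeight f (p / m) (m : ℝ)⁻¹ ζ)
      - ∫ ζ in Ioi (y r), tailWeight f (p / m) (m : ℝ)⁻¹ ζ with hD₂
    have hTD : T (y r / 2) - T (y r) = c₁ * D₁ + c₂ * D₂ := by
      simp only [hT, hD₁, hD₂]
      ring
    have hD₁0 : 0 ≤ D₁ := nonneg_of_mul_nonneg_right (hw1'.trans hw1) (by positivity)
    have hD₂0 : 0 ≤ D₂ := nonneg_of_mul_nonneg_right (hw2'.trans hw2) (by positivity)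
    rw [hTD]
    rcases le_total (2 ^ p * y r ^ p / (s - r) ^ m) (2 * y r / (B * (s - r)) ^ k) with hc | hc
    · have h4 : f (y r) ≤ 4 * K * (y r / (B * (s - r)) ^ k) := by
        refine hg.trans ((mul_le_mul_of_nonneg_left (add_le_add_right hc _) hK.le).trans_eq ?_)
        ring
      have := length_le_of_growth_step hk (by positivity) hyr hf (by positivity) h4 le_rfl
      have h5 := this.trans (mul_le_mul_of_nonneg_left hw1 (by positivity))
      have : s - r ≤ c₁ * D₁ := by
        rw [hc₁, div_mul_eq_mul_div, le_div_iff₀ hB]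
        linarith
      linarith [mul_nonneg hc₂0 hD₂0]
    · have h4 : f (y r) ≤ 2 * 2 ^ p * K * (y r ^ p / (s - r) ^ m) := by
        refine hg.trans ((mul_le_mul_of_nonneg_left (add_le_add_left hc _) hK.le).trans_eq ?_)
        ring
      have := length_le_of_growth_step hm (by positivity) (rpow_pos_of_pos hyr p) hf hδ h4
        (Q := y r ^ (p / m)) (by rw [← rpow_mul hyr.le, div_eq_mul_inv])
      have h5 := this.trans (mul_le_mul_of_nonneg_left hw2 (by positivity))
      have : s - r ≤ c₂ * D₂ := by
        rw [hc₂]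
        linarith
      linarith [mul_nonneg hc₁0 hD₁0]
  have main : ∀ N : ℕ, ∀ r, r₀ ≤ r → r ≤ r₁ → y r₁ ≤ 2 ^ N * y r → r₁ - r ≤ T (y r / 2) := by
    intro N
    induction N with
    | zero =>
      intro r hr hr1 hN
      have hyr := hypos r hr hr1
      rcases hr1.eq_or_lt with rfl | hlt
      · simpa using hTnn _ (half_pos hyr)
      · have := hstep r r₁ hr hlt le_rfl (by linarith)
        linarith [hTnn _ hyr]
    | succ N ih =>
      intro r hr hr1 hN
      have hyr := hypos r hr hr1
      by_contra! hcon
      have hD := hTanti (y r / 2) (y r) (half_pos hyr) (by linarith)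
      have hTr := hTnn _ hyr
      set s := (r + r₁ + T (y r / 2) - 2 * T (y r)) / 2 with hs
      have hrs : r < s := by rw [hs]; linarith
      have hsr : s < r₁ := by rw [hs]; linarith
      rcases le_or_gt (y s) (2 * y r) with h | h
      · have := hstep r s hr hrs hsr.le h
        rw [hs] at this
        linarith
      · have hpow : (0 : ℝ) < 2 ^ N := by positivity
        have h1 := ih s (hr.trans hrs.le) hsr.le (by
          rw [pow_succ] at hN
          nlinarith)
        have h2 := hTanti (y r) (y s / 2) hyr (by linarith)
        have : r₁ - s ≤ T (y r) := h1.trans h2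
        rw [hs] at this
        linarith
  obtain ⟨N, hN⟩ := pow_unbounded_of_one_lt (y r₁ / y r₀) one_lt_two
  exact main N r₀ le_rfl h01 ((div_le_iff₀ hy0).1 hN.le)

section ProductTest

variable {n : ℕ}

/-- `φ` is a product whose spatial factor is dominated, with all derivatives, by the derivatives of
`g` of order `q` higher, and whose time factor is `h`. -/
def IsSpatialDeriv (g : Spc n → ℝ) (h : ℝ → ℝ) (q : ℕ) (φ : Spc n × ℝ → ℝ) : Prop :=
  ∃ G : Spc n → ℝ, (φ = fun z => G z.1 * h z.2) ∧ ContDiff ℝ (⊤ : ℕ∞) G ∧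
    ∀ l x, ‖iteratedFDeriv ℝ l G x‖ ≤ ‖iteratedFDeriv ℝ (l + q) g x‖

lemma IsSpatialDeriv.spDeriv {g : Spc n → ℝ} {h : ℝ → ℝ} {q : ℕ} {φ : Spc n × ℝ → ℝ}
    (hφ : IsSpatialDeriv g h q φ) (i : Fin n) :
    IsSpatialDeriv g h (q + 1) (spDeriv n i φ) := by
  obtain ⟨G, rfl, hG, hb⟩ := hφ
  have hG' : ContDiff ℝ (⊤ : ℕ∞) (fderiv ℝ G) := hG.fderiv_right (by norm_num)
  refine ⟨fun x => fderiv ℝ G x (EuclideanSpace.single i (1 : ℝ)), ?_,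
    hG'.clm_apply contDiff_const, fun l x => ?_⟩
  · funext z
    have hd : DifferentiableAt ℝ G z.1 := hG.differentiable (by simp) z.1
    have := hd.lineDeriv_eq_fderiv (v := EuclideanSpace.single i (1 : ℝ))
    rw [lineDeriv] at this
    simp only [_root_.spDeriv, deriv_mul_const_field, this]
  · refine (norm_iteratedFDeriv_clm_apply_const (hG'.contDiffAt)
      (by exact_mod_cast le_top)).trans ?_
    rw [norm_iteratedFDeriv_fderiv, PiLp.norm_single, norm_one, one_mul]
    refine (hb (l + 1) x).trans_eq ?_
    rw [add_right_comm, add_assoc]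

lemma IsSpatialDeriv.iterate_spDeriv {g : Spc n → ℝ} {h : ℝ → ℝ} {q : ℕ} {φ : Spc n × ℝ → ℝ}
    (hφ : IsSpatialDeriv g h q φ) (i : Fin n) (j : ℕ) :
    IsSpatialDeriv g h (q + j) ((_root_.spDeriv n i)^[j] φ) := by
  induction j with
  | zero => exact hφ
  | succ j ih =>
    rw [Function.iterate_succ_apply']
    exact ih.spDeriv i

lemma exists_mDeriv_mul_eq {g : Spc n → ℝ} (hg : ContDiff ℝ (⊤ : ℕ∞) g) (h : ℝ → ℝ)
    (α : Fin n → ℕ) :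
    ∃ G : Spc n → ℝ, (mDeriv n α (fun z => g z.1 * h z.2) = fun z => G z.1 * h z.2) ∧
      ∀ x, |G x| ≤ ‖iteratedFDeriv ℝ (∑ i, α i) g x‖ := by
  have key : ∀ L : List (Fin n), IsSpatialDeriv g h (L.map α).sum
      (L.foldr (fun i ψ => (spDeriv n i)^[α i] ψ) (fun z => g z.1 * h z.2)) := by
    intro L
    induction L with
    | nil => exact ⟨g, rfl, hg, fun l x => le_rfl⟩
    | cons i L ih =>
      rw [List.map_cons, List.sum_cons, List.foldr_cons, add_comm]
      exact ih.iterate_spDeriv i (α i)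
  obtain ⟨G, hG, -, hb⟩ := key (List.finRange n)
  refine ⟨G, hG, fun x => ?_⟩
  have := hb 0 x
  rwa [norm_iteratedFDeriv_zero, zero_add, ← Fin.sum_univ_def] at this

lemma iterate_tDeriv_mul (g : Spc n → ℝ) (h : ℝ → ℝ) (j : ℕ) :
    (tDeriv n)^[j] (fun z => g z.1 * h z.2) = fun z => g z.1 * iteratedDeriv j h z.2 := by
  induction j with
  | zero => simp
  | succ j ih =>
    rw [Function.iterate_succ_apply', ih, iteratedDeriv_succ]
    funext z
    simp only [tDeriv, deriv_const_mul_field]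

end ProductTest

section Cylinder

variable {n : ℕ}

lemma isOpen_cyl (r κ : ℝ) : IsOpen (cyl n r κ) := Metric.isOpen_ball.prod isOpen_Ioo

lemma measurableSet_cyl (r κ : ℝ) : MeasurableSet (cyl n r κ) := (isOpen_cyl r κ).measurableSet

lemma cyl_subset_halfSp (r κ : ℝ) : cyl n r κ ⊆ halfSp n := fun _ hz => hz.2.1

lemma cyl_mono {r s κ : ℝ} (hr : 0 ≤ r) (hrs : r ≤ s) (hκ : 0 ≤ κ) : cyl n r κ ⊆ cyl n s κ :=
  prod_mono (Metric.ball_subset_ball hrs) (Ioo_subset_Ioo_right (rpow_le_rpow hr hrs hκ))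

lemma integrableOn_cyl_of_forall {v : Spc n × ℝ → ℝ}
    (hv : ∀ r : ℝ, 0 < r → IntegrableOn v (cyl n r 1)) {r κ : ℝ} (hr : 0 < r) :
    IntegrableOn v (cyl n r κ) := by
  refine (hv (max r (r ^ κ)) (hr.trans_le (le_max_left _ _))).mono_set ?_
  refine prod_mono (Metric.ball_subset_ball (le_max_left _ _)) (Ioo_subset_Ioo_right ?_)
  rw [rpow_one]
  exact le_max_right _ _

lemma mem_halfSp_diff_cyl {r κ : ℝ} {z : Spc n × ℝ} (hz : z ∈ halfSp n \ cyl n r κ) :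
    r ≤ ‖z.1‖ ∨ r ^ κ ≤ ‖z.2‖ := by
  by_contra! h
  refine hz.2 ⟨mem_ball_zero_iff.2 h.1, hz.1, ?_⟩
  exact (le_abs_self z.2).trans_lt h.2

lemma volume_real_cyl {r κ : ℝ} (hr : 0 < r) :
    volume.real (cyl n r κ) = volume.real (ball0 n 1) * r ^ ((n : ℝ) + κ) := by
  have h1 : volume.real (ball0 n r) = r ^ n * volume.real (ball0 n 1) := by
    rw [measureReal_def, ball0, Measure.addHaar_ball_of_pos _ _ hr, ENNReal.toReal_mul,
      ENNReal.toReal_ofReal (by positivity), finrank_euclideanSpace_fin]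
    rfl
  rw [cyl, Measure.volume_eq_prod, measureReal_prod_prod, h1,
    Real.volume_real_Ioo_of_le (rpow_nonneg hr.le κ), rpow_add hr, rpow_natCast]
  ring

lemma volume_real_ball0_one_pos : 0 < volume.real (ball0 n 1) :=
  ENNReal.toReal_pos (Metric.measure_ball_pos volume 0 one_pos).ne' measure_ball_lt_top.ne

lemma volume_cyl_pos {r κ : ℝ} (hr : 0 < r) : volume (cyl n r κ) ≠ 0 ∧ volume (cyl n r κ) ≠ ⊤ := by
  have h : 0 < volume.real (cyl n r κ) := by
    rw [volume_real_cyl hr]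
    exact mul_pos volume_real_ball0_one_pos (rpow_pos_of_pos hr _)
  exact ⟨fun h0 => by simp [measureReal_def, h0] at h,
    fun h0 => by simp [measureReal_def, h0] at h⟩

end Cylinder

lemma GoodF.zero_le {p : ℝ} {f : ℝ → ℝ} (hf : GoodF p f) {ζ : ℝ} (hζ : 0 ≤ ζ) : 0 ≤ f ζ := by
  obtain ⟨hmono, hconv, -, -, hpos⟩ := hf
  refine le_trans ?_ (hmono self_mem_Ici hζ hζ)
  have hev : ∀ᶠ s in nhdsWithin (0 : ℝ) (Ioi 0), 0 ≤ (1 - s) * f 0 + s * f 1 := by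
    filter_upwards [Ioo_mem_nhdsGT (zero_lt_one' ℝ)] with s hs
    have := hconv.2 (self_mem_Ici (a := (0 : ℝ))) (mem_Ici.2 zero_le_one) (sub_nonneg.2 hs.2.le)
      hs.1.le (by ring)
    simp only [smul_eq_mul, mul_zero, mul_one, zero_add] at this
    exact (hpos s hs.1).le.trans this
  have hlim : Tendsto (fun s : ℝ => (1 - s) * f 0 + s * f 1) (nhdsWithin (0 : ℝ) (Ioi 0))
      (nhds (f 0)) := by
    have : Continuous fun s : ℝ => (1 - s) * f 0 + s * f 1 := by fun_prop
    simpa using (this.tendsto 0).mono_left nhdsWithin_le_nhds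
  exact ge_of_tendsto hlim hev

lemma ConvexOn.continuousOn_Ici_of_monotoneOn {g : ℝ → ℝ} (hconv : ConvexOn ℝ (Ici 0) g)
    (hmono : MonotoneOn g (Ici 0)) : ContinuousOn g (Ici 0) := by
  intro x hx
  rcases (mem_Ici.1 hx).eq_or_lt with rfl | hx0
  · have hlim : Tendsto (fun s : ℝ => (1 - s) * g 0 + s * g 1) (nhdsWithin (0 : ℝ) (Ici 0))
        (nhds (g 0)) := by
      have : Continuous fun s : ℝ => (1 - s) * g 0 + s * g 1 := by fun_prop
      simpa using (this.tendsto 0).mono_left nhdsWithin_le_nhds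
    refine tendsto_of_tendsto_of_tendsto_of_le_of_le' tendsto_const_nhds hlim ?_ ?_
    · filter_upwards [self_mem_nhdsWithin] with s hs using hmono self_mem_Ici hs hs
    · filter_upwards [Icc_mem_nhdsGE (zero_lt_one' ℝ)] with s hs
      have := hconv.2 (self_mem_Ici (a := (0 : ℝ))) (mem_Ici.2 zero_le_one) (sub_nonneg.2 hs.2)
        hs.1 (by ring)
      simpa only [smul_eq_mul, mul_zero, mul_one, zero_add] using this
  · have := hconv.continuousOn_interior
    rw [interior_Ici] at this
    exact (this.continuousAt (Ioi_mem_nhds hx0)).continuousWithinAt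

/-- The initial data do not contribute with a negative sign when the test function is a product
whose time factor is constant near `t = 0`. -/
lemma integral_initial_nonneg {n k : ℕ} (hk : 1 ≤ k) {u0 : ℕ → Spc n → ℝ}
    (hu0 : ∀ᵐ x ∂(volume : Measure (Spc n)), 0 ≤ u0 (k - 1) x) {g : Spc n → ℝ} {h : ℝ → ℝ}
    (hg : ∀ x, 0 ≤ g x) (hh : h =ᶠ[nhds 0] fun _ => 1) :
    0 ≤ ∫ x : Spc n, ∑ i ∈ Finset.range k,
      (-1 : ℝ) ^ i * u0 (k - 1 - i) x * (tDeriv n)^[i] (fun z => g z.1 * h z.2) (x, 0) := by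
  refine integral_nonneg_of_ae ?_
  filter_upwards [hu0] with x hx
  rw [Finset.sum_eq_single_of_mem 0 (Finset.mem_range.2 hk) fun i _ hi => ?_]
  · simp only [pow_zero, one_mul, Nat.sub_zero, Function.iterate_zero, id, hh.eq_of_nhds, mul_one]
    exact mul_nonneg hx (hg x)
  · rw [iterate_tDeriv_mul]
    have : iteratedDeriv i h 0 = 0 := by
      rw [hh.iteratedDeriv_eq, iteratedDeriv_const, if_neg hi]
    simp [this]

/-- The local energy estimate obtained by testing with a cutoff function between two cylinders. -/
theorem exists_energy_bound (n k m : ℕ) (hk : 1 ≤ k) (A p : ℝ) (hA : 0 < A) :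
    ∃ K : ℝ, 0 < K ∧ ∀ (a : (Fin n → ℕ) → Spc n × ℝ → ℝ → ℝ) (f : ℝ → ℝ)
      (u0 : ℕ → Spc n → ℝ) (u : Spc n × ℝ → ℝ), Standing n k m A p a f u0 →
      IsGlobalWeakSol n k m p a f u0 u → ∀ κ : ℝ, 0 < κ → ∀ r s : ℝ, 0 < r → r < s →
      ∫ z in cyl n r κ, f |u z| ≤
        K * ((∫ z in cyl n s κ, |u z|) / (s ^ κ - r ^ κ) ^ k
          + (∫ z in cyl n s κ, |u z| ^ p) / (s - r) ^ m) := by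
  obtain ⟨c, hc, hcut⟩ := exists_radial_cutoff (Spc n)
  obtain ⟨d, hd, hcut'⟩ := exists_radial_cutoff ℝ
  set K₁ := c 0 * d k with hK₁
  set K₂ := A * (mIdx n m).card * (c m * d 0) with hK₂
  have hK₁0 : 0 < K₁ := mul_pos (hc 0) (hd k)
  have hK₂0 : 0 ≤ K₂ := by
    have := hc m
    have := hd 0
    positivity
  refine ⟨K₁ + K₂, by positivity, fun a f u0 u hS hu κ hκ r s hr hrs => ?_⟩
  obtain ⟨ha, hf, -, hu0, -, -⟩ := hS
  obtain ⟨hu1, hup, huf, htest⟩ := hu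
  have hs : 0 < s := hr.trans hrs
  have hrsκ : r ^ κ < s ^ κ := rpow_lt_rpow hr.le hrs hκ
  obtain ⟨g, hgs, hgc, hg0, hg1, hgb, hgv⟩ := hcut r s hr hrs
  obtain ⟨h, hhs, hhc, hh0, hh1, hhb, hhv⟩ := hcut' (r ^ κ) (s ^ κ) (rpow_pos_of_pos hr κ) hrsκ
  have hgle : ∀ x, |g x| ≤ c 0 := fun x => by simpa using hgb 0 x
  have hhle : ∀ t, |h t| ≤ d 0 := fun t => by simpa using hhb 0 t
  have hgz : ∀ x, s ≤ ‖x‖ → g x = 0 := fun x hx => by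
    have := congrArg norm (hgv 0 x hx)
    rwa [norm_iteratedFDeriv_zero, norm_zero, norm_eq_zero] at this
  have hhz : ∀ t, s ^ κ ≤ ‖t‖ → h t = 0 := fun t ht => by
    have := congrArg norm (hhv 0 t ht)
    rwa [norm_iteratedFDeriv_zero, norm_zero, norm_eq_zero] at this
  have hhd : ∀ t, |iteratedDeriv k h t| ≤ d k / (s ^ κ - r ^ κ) ^ k := fun t => by
    rw [← Real.norm_eq_abs, ← norm_iteratedFDeriv_eq_norm_iteratedDeriv]
    exact hhb k t
  have hhdz : ∀ t, s ^ κ ≤ ‖t‖ → iteratedDeriv k h t = 0 := fun t ht => by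
    rw [← norm_eq_zero, ← norm_iteratedFDeriv_eq_norm_iteratedDeriv, hhv k t ht, norm_zero]
  set φ : Spc n × ℝ → ℝ := fun z => g z.1 * h z.2 with hφ
  have hφs : ContDiff ℝ (⊤ : ℕ∞) φ := (hgs.comp contDiff_fst).mul (hhs.comp contDiff_snd)
  have hφc : HasCompactSupport φ := by
    refine HasCompactSupport.intro (hgc.isCompact.prod hhc.isCompact) fun z hz => ?_
    rw [mem_prod, not_and_or] at hz
    rcases hz with hz | hz
    · simp [hφ, image_eq_zero_of_notMem_tsupport hz]
    · simp [hφ, image_eq_zero_of_notMem_tsupport hz]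
  have hφ0 : ∀ z, 0 ≤ φ z := fun z => mul_nonneg (hg0 _) (hh0 _)
  have hφz : ∀ z, s ≤ ‖z.1‖ ∨ s ^ κ ≤ ‖z.2‖ → φ z = 0 := by
    rintro z (hz | hz)
    · simp [hφ, hgz _ hz]
    · simp [hφ, hhz _ hz]
  have hφ1 : ∀ z ∈ cyl n r κ, φ z = 1 := fun z hz => by
    have h1 := hg1 z.1 (mem_ball_zero_iff.1 hz.1)
    have h2 := hh1 z.2 (by rw [Real.norm_of_nonneg hz.2.1.le]; exact hz.2.2)
    simp [hφ, h1, h2]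
  have hinit := integral_initial_nonneg hk hu0 hg0 (h := h) (by
    filter_upwards [Metric.ball_mem_nhds (0 : ℝ) (rpow_pos_of_pos hr κ)] with t ht
    exact hh1 t (mem_ball_zero_iff.1 ht))
  have hineq := htest φ hφs hφc hφ0
  have hmeas : MeasurableSet (halfSp n) := measurableSet_lt measurable_const measurable_snd
  have hrestr : ∀ F : Spc n × ℝ → ℝ, (∀ z, s ≤ ‖z.1‖ ∨ s ^ κ ≤ ‖z.2‖ → F z = 0) →
      ∫ z in halfSp n, F z = ∫ z in cyl n s κ, F z := fun F hF =>
    setIntegral_eq_of_subset_of_forall_sdiff_eq_zero hmeas (cyl_subset_halfSp s κ)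
      fun z hz => hF z (mem_halfSp_diff_cyl hz)
  have hlow : ∫ z in cyl n r κ, f |u z| ≤ ∫ z in halfSp n, f |u z| * φ z := by
    rw [hrestr _ fun z hz => by rw [hφz z hz, mul_zero]]
    have hint : IntegrableOn (fun z => f |u z| * φ z) (cyl n s κ) :=
      (integrableOn_cyl_of_forall huf hs).mul_bdd (c := c 0 * d 0)
        hφs.continuous.aestronglyMeasurable
        (.of_forall fun z => by
          rw [hφ, norm_mul]
          exact mul_le_mul (hgle _) (hhle _) (norm_nonneg _) (hc 0).le)
    calc ∫ z in cyl n r κ, f |u z| = ∫ z in cyl n r κ, f |u z| * φ z :=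
          setIntegral_congr_fun (measurableSet_cyl r κ) fun z hz => by simp [hφ1 z hz]
      _ ≤ _ := setIntegral_mono_set hint
          (.of_forall fun z => mul_nonneg (hf.zero_le (abs_nonneg _)) (hφ0 z))
          (cyl_mono hr.le hrs.le hκ.le).eventuallyLE
  have htime : ∫ z in halfSp n, (-1 : ℝ) ^ k * u z * (tDeriv n)^[k] φ z ≤
      K₁ * ((∫ z in cyl n s κ, |u z|) / (s ^ κ - r ^ κ) ^ k) := by
    rw [hφ, iterate_tDeriv_mul, hrestr]
    · refine (Real.le_norm_self _).trans ((norm_integral_le_of_norm_le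
        ((integrableOn_cyl_of_forall (κ := κ) hu1 hs).abs.mul_const (K₁ / (s ^ κ - r ^ κ) ^ k))
        (.of_forall fun z => ?_)).trans_eq ?_)
      · rw [norm_mul, norm_mul, norm_pow, norm_neg, norm_one, one_pow, one_mul,
          Real.norm_eq_abs, hK₁, mul_div_assoc, norm_mul]
        exact mul_le_mul_of_nonneg_left
          (mul_le_mul (hgle _) (hhd _) (norm_nonneg _) (hc 0).le) (abs_nonneg _)
      · rw [integral_mul_const]
        ring
    · rintro z (hz | hz)
      · simp [hgz _ hz]
      · simp [hhdz _ hz]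
  have hspace : -(∫ z in halfSp n, ∑ α ∈ mIdx n m, (-1 : ℝ) ^ m * a α z (u z) * mDeriv n α φ z) ≤
      K₂ * ((∫ z in cyl n s κ, |u z| ^ p) / (s - r) ^ m) := by
    choose G hG hGb using exists_mDeriv_mul_eq hgs h
    have hsum : ∀ α ∈ mIdx n m, ∑ i, α i = m := fun α hα => (Finset.mem_filter.1 hα).2
    rw [hrestr]
    · have hae : ∀ᵐ z ∂(volume.restrict (cyl n s κ)), ∀ α ∈ mIdx n m,
          |a α z (u z)| ≤ A * |u z| ^ p := by
        rw [Finset.eventually_all]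
        intro α hα
        filter_upwards [ae_restrict_of_ae_restrict_of_subset (cyl_subset_halfSp s κ)
          (ha α hα).2.2] with z hz
        exact hz (u z)
      refine (neg_le_abs _).trans ((Real.norm_eq_abs _).symm.trans_le <| (norm_integral_le_of_norm_le
        ((integrableOn_cyl_of_forall (κ := κ) hup hs).mul_const (K₂ / (s - r) ^ m)) ?_).trans_eq ?_)
      · filter_upwards [hae] with z hz
        refine (norm_sum_le_of_le _ (n := fun _ => A * |u z| ^ p * (c m / (s - r) ^ m * d 0))
          fun α hα => ?_).trans_eq ?_
        · rw [hφ, hG α, norm_mul, norm_mul, norm_pow, norm_neg, norm_one, one_pow, one_mul,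
            norm_mul]
          have h1 : ‖G α z.1‖ ≤ c m / (s - r) ^ m := (hGb α z.1).trans (by
            rw [hsum α hα]
            exact hgb m z.1)
          exact mul_le_mul (hz α hα)
            (mul_le_mul h1 (hhle _) (norm_nonneg _) ((norm_nonneg _).trans h1))
            (by positivity) ((abs_nonneg _).trans (hz α hα))
        · rw [Finset.sum_const, nsmul_eq_mul, hK₂]
          ring
      · rw [integral_mul_const]
        ring
    · intro z hz
      refine Finset.sum_eq_zero fun α hα => ?_
      rw [hφ, hG α]
      rcases hz with hz | hz
      · have := hGb α z.1
        rw [hsum α hα, hgv m _ hz, norm_zero] at this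
        simp [abs_nonpos_iff.1 this]
      · simp [hhz _ hz]
  have hI1 : 0 ≤ (∫ z in cyl n s κ, |u z|) / (s ^ κ - r ^ κ) ^ k :=
    div_nonneg (integral_nonneg fun z => abs_nonneg _) (pow_nonneg (sub_pos.2 hrsκ).le _)
  have hI2 : 0 ≤ (∫ z in cyl n s κ, |u z| ^ p) / (s - r) ^ m :=
    div_nonneg (integral_nonneg fun z => by positivity) (pow_nonneg (sub_pos.2 hrs).le _)
  nlinarith [mul_nonneg hK₁0.le hI2, mul_nonneg hK₂0 hI1]

section Averages

variable {n : ℕ} {p κ r : ℝ} {u : Spc n × ℝ → ℝ}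

lemma GoodF.apply_average_le {f : ℝ → ℝ} (hf : GoodF p f) (hp : 0 < p) (hr : 0 < r)
    (hup : IntegrableOn (fun z => |u z| ^ p) (cyl n r κ))
    (huf : IntegrableOn (fun z => f |u z|) (cyl n r κ)) :
    f ((⨍ z in cyl n r κ, |u z| ^ p) ^ (1 / p)) ≤ ⨍ z in cyl n r κ, f |u z| := by
  obtain ⟨-, -, hmono, hconv, -⟩ := hf
  have hcomp : ∀ z, f ((|u z| ^ p) ^ (1 / p)) = f |u z| := fun z => by
    rw [one_div, rpow_rpow_inv (abs_nonneg _) hp.ne']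
  have := hconv.map_set_average_le (hconv.continuousOn_Ici_of_monotoneOn hmono) isClosed_Ici
    (volume_cyl_pos hr).1 (volume_cyl_pos hr).2
    (.of_forall fun z => rpow_nonneg (abs_nonneg (u z)) p) hup
    (by simpa only [Function.comp_def, hcomp] using huf)
  simpa only [hcomp] using this

lemma average_abs_le_rpow_average (hp : 1 ≤ p) (hr : 0 < r) (hu : IntegrableOn u (cyl n r κ))
    (hup : IntegrableOn (fun z => |u z| ^ p) (cyl n r κ)) :
    ⨍ z in cyl n r κ, |u z| ≤ (⨍ z in cyl n r κ, |u z| ^ p) ^ (1 / p) := by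
  have hp0 : 0 < p := one_pos.trans_le hp
  have := (convexOn_rpow hp).map_set_average_le
    ((continuous_rpow_const hp0.le).continuousOn) isClosed_Ici
    (volume_cyl_pos hr).1 (volume_cyl_pos hr).2
    (.of_forall fun z => abs_nonneg (u z)) hu.abs hup
  have h0 : 0 ≤ ⨍ z in cyl n r κ, |u z| := by
    rw [setAverage_eq]
    exact smul_nonneg (by positivity) (integral_nonneg fun z => abs_nonneg _)
  have h2 := rpow_le_rpow (rpow_nonneg h0 p) this (one_div_nonneg.2 hp0.le)
  rwa [one_div, rpow_rpow_inv h0 hp0.ne', ← one_div] at h2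

end Averages

lemma mul_sub_le_rpow_sub_rpow {κ R r s : ℝ} (hκ : 0 < κ) (hR : 0 < R) (hr : R ≤ r) (hrs : r < s)
    (hs : s ≤ 2 * R) : κ * R ^ κ / (2 * R) * (s - r) ≤ s ^ κ - r ^ κ := by
  have hne : ∀ x ∈ Icc r s, x ≠ 0 := fun x hx => ((hR.trans_le hr).trans_le hx.1).ne'
  obtain ⟨c, hc, hslope⟩ := exists_deriv_eq_slope (fun x : ℝ => x ^ κ) hrs
    (fun x hx => (continuousAt_rpow_const x κ (Or.inl (hne x hx))).continuousWithinAt)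
    (fun x hx => (hasDerivAt_rpow_const (Or.inl (hne x
      (Ioo_subset_Icc_self hx)))).differentiableAt.differentiableWithinAt)
  have hc0 : 0 < c := (hR.trans_le hr).trans hc.1
  rw [Real.deriv_rpow_const, rpow_sub_one hc0.ne', eq_div_iff (sub_pos.2 hrs).ne'] at hslope
  rw [← hslope, mul_div_assoc]
  have h1 : R ^ κ ≤ c ^ κ := rpow_le_rpow hR.le (hr.trans hc.1.le) hκ.le
  have h2 : c ≤ 2 * R := hc.2.le.trans hs
  have := sub_pos.2 hrs
  gcongr

/-- The normalized `L^p` mean of a solution over the cylinders `cyl n r κ`, `R ≤ r ≤ 2 R`,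
satisfies the growth inequality feeding the doubling argument. -/
theorem exists_growth_bound (n k m : ℕ) (hk : 1 ≤ k) (A p : ℝ) (hA : 0 < A) (hp : 1 ≤ p)
    (κ : ℝ) (hκ : 0 < κ) :
    ∃ K τ : ℝ, 0 < K ∧ 0 < τ ∧ ∀ (a : (Fin n → ℕ) → Spc n × ℝ → ℝ → ℝ) (f : ℝ → ℝ)
      (u0 : ℕ → Spc n → ℝ) (u : Spc n × ℝ → ℝ), Standing n k m A p a f u0 →
      IsGlobalWeakSol n k m p a f u0 u → ∀ R r s : ℝ, 0 < R → R ≤ r → r < s → s ≤ 2 * R →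
      f ((τ / R ^ ((n : ℝ) + κ) * ∫ z in cyl n r κ, |u z| ^ p) ^ (1 / p)) ≤
        K * ((τ / R ^ ((n : ℝ) + κ) * ∫ z in cyl n s κ, |u z| ^ p) ^ (1 / p) /
              (κ * R ^ κ / (2 * R) * (s - r)) ^ k
          + ((τ / R ^ ((n : ℝ) + κ) * ∫ z in cyl n s κ, |u z| ^ p) ^ (1 / p)) ^ p /
              (s - r) ^ m) := by
  obtain ⟨K, hK, henergy⟩ := exists_energy_bound n k m hk A p hA
  have hp0 : 0 < p := one_pos.trans_le hp
  set e : ℝ := (n : ℝ) + κ with he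
  have he0 : 0 ≤ e := by positivity
  set ω := volume.real (ball0 n 1) with hω
  have hω0 : 0 < ω := volume_real_ball0_one_pos
  set Λ : ℝ := 2 ^ e with hΛ
  have hΛ1 : 1 ≤ Λ := one_le_rpow one_le_two he0
  have hΛ0 : 0 < Λ := one_pos.trans_le hΛ1
  refine ⟨Λ ^ 2 * K, (ω * Λ)⁻¹, by positivity, by positivity,
    fun a f u0 u hS hu R r s hR hr hrs hs => ?_⟩
  have hr0 : 0 < r := hR.trans_le hr
  have hs0 : 0 < s := hr0.trans hrs
  have hf : GoodF p f := hS.2.1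
  have hen := henergy a f u0 u hS hu κ hκ r s hr0 hrs
  obtain ⟨hu1, hup, huf, -⟩ := hu
  set V := ω * Λ * R ^ e with hV
  have hV0 : 0 < V := by positivity
  have hτ : (ω * Λ)⁻¹ / R ^ e = V⁻¹ := by rw [hV, mul_inv (ω * Λ), div_eq_mul_inv]
  rw [hτ]
  have hvol : ∀ q, R ≤ q → q ≤ 2 * R →
      volume.real (cyl n q κ) ≤ V ∧ V ≤ Λ * volume.real (cyl n q κ) := fun q hq hq' => by
    rw [volume_real_cyl (hR.trans_le hq), ← hω, ← he]
    have h1 : q ^ e ≤ Λ * R ^ e := by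
      rw [hΛ, ← mul_rpow zero_le_two hR.le]
      exact rpow_le_rpow (hR.trans_le hq).le hq' he0
    have h2 : R ^ e ≤ q ^ e := rpow_le_rpow hR.le hq he0
    constructor
    · nlinarith
    · nlinarith [mul_le_mul_of_nonneg_left h2 (mul_pos hω0 hΛ0).le]
  have hvr := hvol r hr (hrs.le.trans hs)
  have hvs := hvol s (hr.trans hrs.le) hs
  have hvr0 : 0 < volume.real (cyl n r κ) := pos_of_mul_pos_right (hV0.trans_le hvr.2) hΛ0.le
  have hvs0 : 0 < volume.real (cyl n s κ) := pos_of_mul_pos_right (hV0.trans_le hvs.2) hΛ0.le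
  have hinv : ∀ q, 0 < volume.real (cyl n q κ) → V ≤ Λ * volume.real (cyl n q κ) →
      (volume.real (cyl n q κ))⁻¹ ≤ Λ * V⁻¹ := fun q hq hVq => by
    rw [← div_eq_mul_inv, inv_le_comm₀ hq (by positivity), inv_div, div_le_iff₀ hΛ0]
    linarith
  have hIr : 0 ≤ ∫ z in cyl n r κ, |u z| ^ p := integral_nonneg fun z => by positivity
  have hIs : 0 ≤ ∫ z in cyl n s κ, |u z| ^ p := integral_nonneg fun z => by positivity
  set Ys := (V⁻¹ * ∫ z in cyl n s κ, |u z| ^ p) ^ (1 / p) with hYs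
  have hYs0 : 0 ≤ Ys := by positivity
  have hYsp : Ys ^ p = V⁻¹ * ∫ z in cyl n s κ, |u z| ^ p := by
    rw [hYs, one_div, rpow_inv_rpow (by positivity) hp0.ne']
  have hmean : V⁻¹ * ∫ z in cyl n s κ, |u z| ≤ Λ * Ys := by
    have h0 : 0 ≤ ∫ z in cyl n s κ, |u z| := integral_nonneg fun z => abs_nonneg _
    have h1 := average_abs_le_rpow_average hp hs0 (integrableOn_cyl_of_forall (κ := κ) hu1 hs0)
      (integrableOn_cyl_of_forall hup hs0)
    rw [setAverage_eq, setAverage_eq, smul_eq_mul, smul_eq_mul] at h1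
    calc V⁻¹ * ∫ z in cyl n s κ, |u z|
        ≤ (volume.real (cyl n s κ))⁻¹ * ∫ z in cyl n s κ, |u z| :=
          mul_le_mul_of_nonneg_right (inv_anti₀ hvs0 hvs.1) h0
      _ ≤ _ := h1
      _ ≤ (Λ * (V⁻¹ * ∫ z in cyl n s κ, |u z| ^ p)) ^ (1 / p) := by
          rw [← mul_assoc]
          exact rpow_le_rpow (by positivity)
            (mul_le_mul_of_nonneg_right (hinv s hvs0 hvs.2) hIs) (by positivity)
      _ = Λ ^ (1 / p) * Ys := mul_rpow hΛ0.le (by positivity)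
      _ ≤ Λ * Ys := by
          refine mul_le_mul_of_nonneg_right ?_ hYs0
          exact (rpow_le_rpow_of_exponent_le hΛ1 ((div_le_one hp0).2 hp)).trans_eq (rpow_one Λ)
  have hgap := mul_sub_le_rpow_sub_rpow hκ hR hr hrs hs
  have hδ : 0 < s - r := sub_pos.2 hrs
  have hBδ : 0 < κ * R ^ κ / (2 * R) * (s - r) := by positivity
  have hfint : 0 ≤ ∫ z in cyl n r κ, f |u z| :=
    integral_nonneg fun z => hf.zero_le (abs_nonneg _)
  calc f ((V⁻¹ * ∫ z in cyl n r κ, |u z| ^ p) ^ (1 / p))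
      ≤ f ((⨍ z in cyl n r κ, |u z| ^ p) ^ (1 / p)) := by
        have hle : V⁻¹ * (∫ z in cyl n r κ, |u z| ^ p) ≤ ⨍ z in cyl n r κ, |u z| ^ p := by
          rw [setAverage_eq, smul_eq_mul]
          exact mul_le_mul_of_nonneg_right (inv_anti₀ hvr0 hvr.1) hIr
        have h0 : 0 ≤ V⁻¹ * ∫ z in cyl n r κ, |u z| ^ p := by positivity
        exact hf.1 (rpow_nonneg h0 _) (rpow_nonneg (h0.trans hle) _)
          (rpow_le_rpow h0 hle (by positivity))
    _ ≤ ⨍ z in cyl n r κ, f |u z| := hf.apply_average_le hp0 hr0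
        (integrableOn_cyl_of_forall hup hr0) (integrableOn_cyl_of_forall huf hr0)
    _ = (volume.real (cyl n r κ))⁻¹ * ∫ z in cyl n r κ, f |u z| := by
        rw [setAverage_eq, smul_eq_mul]
    _ ≤ Λ * V⁻¹ * (K * ((∫ z in cyl n s κ, |u z|) / (s ^ κ - r ^ κ) ^ k
          + (∫ z in cyl n s κ, |u z| ^ p) / (s - r) ^ m)) :=
        mul_le_mul (hinv r hvr0 hvr.2) hen hfint (by positivity)
    _ = Λ * K * ((V⁻¹ * ∫ z in cyl n s κ, |u z|) / (s ^ κ - r ^ κ) ^ k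
          + (V⁻¹ * ∫ z in cyl n s κ, |u z| ^ p) / (s - r) ^ m) := by ring
    _ ≤ Λ * K * (Λ * Ys / (κ * R ^ κ / (2 * R) * (s - r)) ^ k
          + Λ * Ys ^ p / (s - r) ^ m) := by
        rw [← hYsp]
        have : Ys ^ p ≤ Λ * Ys ^ p := le_mul_of_one_le_left (rpow_nonneg hYs0 p) hΛ1
        gcongr
    _ = _ := by ring

/-- **Lemma 3.4.** Let `p ≥ 1`. For every `κ > 0` there are `C, σ > 0`, depending only
on `A, k, m, n, p, κ`, such that for every global weak solution `u` and every `R > 0`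
with `mes {(x,t) ∈ Q_R^κ : u ≠ 0} > 0`,
`F_κ((σ R^{-(n+κ)} ∫_{Q_R^κ} |u|^p)^{1/p}) ≥ C R`. -/
theorem lemma_3_4
    (n k m : ℕ) (hn : 1 ≤ n) (hk : 1 ≤ k) (hm : 1 ≤ m)
    (A p : ℝ) (hA : 0 < A) (hp : 1 ≤ p) (κ : ℝ) (hκ : 0 < κ) :
    ∃ C σ : ℝ, 0 < C ∧ 0 < σ ∧
      ∀ (a : (Fin n → ℕ) → Spc n × ℝ → ℝ → ℝ) (f : ℝ → ℝ) (u0 : ℕ → Spc n → ℝ)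
        (u : Spc n × ℝ → ℝ), Standing n k m A p a f u0 →
        IsGlobalWeakSol n k m p a f u0 u →
        ∀ R : ℝ, 0 < R →
          0 < volume {z : Spc n × ℝ | z ∈ cyl n R κ ∧ u z ≠ 0} →
          C * R ≤
            Fkappa k m p κ f
              ((σ / R ^ ((n : ℝ) + κ) * ∫ z in cyl n R κ, |u z| ^ p) ^ (1 / p)) := by
  obtain ⟨K, τ, hK, hτ, hgrowth⟩ := exists_growth_bound n k m hk A p hA hp κ hκ
  have hp0 : 0 < p := one_pos.trans_le hp
  set C₁ : ℝ := (4 * K) ^ ((k : ℝ)⁻¹) * 2 ^ ((k : ℝ)⁻¹ + 1) with hC₁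
  set C₂ : ℝ := (2 * 2 ^ p * K) ^ ((m : ℝ)⁻¹) * 2 ^ (p / m + 1) with hC₂
  have hC₁0 : 0 < C₁ := by positivity
  have hC₂0 : 0 < C₂ := by positivity
  refine ⟨min ((κ / (4 * C₁)) ^ κ⁻¹) (1 / (2 * C₂)), τ / 2 ^ p, by positivity, by positivity,
    fun a f u0 u hS hu R hR hpos => ?_⟩
  have hf : GoodF p f := hS.2.1
  set y : ℝ → ℝ := fun r => (τ / R ^ ((n : ℝ) + κ) * ∫ z in cyl n r κ, |u z| ^ p) ^ (1 / p) with hy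
  have hint : ∀ r, 0 < r → IntegrableOn (fun z => |u z| ^ p) (cyl n r κ) := fun r hr =>
    integrableOn_cyl_of_forall hu.2.1 hr
  have hy0 : 0 < y R := by
    have h0 : 0 < ∫ z in cyl n R κ, |u z| ^ p := by
      rw [setIntegral_pos_iff_support_of_nonneg_ae (.of_forall fun z => by positivity) (hint R hR)]
      refine hpos.trans_le (measure_mono fun z hz => ⟨?_, hz.1⟩)
      exact (rpow_pos_of_pos (abs_pos.2 hz.2) p).ne'
    simp only [hy]
    positivity
  have hymono : MonotoneOn y (Icc R (2 * R)) := fun r hr s hs hrs => by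
    have hr0 : 0 < r := hR.trans_le hr.1
    have h0 : 0 ≤ ∫ z in cyl n r κ, |u z| ^ p := integral_nonneg fun z => by positivity
    have hle : ∫ z in cyl n r κ, |u z| ^ p ≤ ∫ z in cyl n s κ, |u z| ^ p :=
      setIntegral_mono_set (hint s (hR.trans_le hs.1)) (.of_forall fun z => by positivity)
        (cyl_mono hr0.le hrs hκ.le).eventuallyLE
    exact rpow_le_rpow (by positivity) (mul_le_mul_of_nonneg_left hle (by positivity))
      (by positivity)
  have hlen := length_le_tail_integrals (f := f) (y := y) (B := κ * R ^ κ / (2 * R))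
    (by omega : k ≠ 0) (by omega : m ≠ 0) hp0 hK (by positivity) hf.1 hf.2.2.2.2
    hS.2.2.2.2.1 hS.2.2.2.2.2 (by linarith) hymono hy0
    (fun r s hr hrs hs => hgrowth a f u0 u hS hu R r s hR hr hrs hs)
  have harg : (τ / 2 ^ p / R ^ ((n : ℝ) + κ) * ∫ z in cyl n R κ, |u z| ^ p) ^ (1 / p)
      = y R / 2 := by
    have h0 : 0 ≤ ∫ z in cyl n R κ, |u z| ^ p := integral_nonneg fun z => by positivity
    have h2 : ((2 : ℝ) ^ p) ^ (1 / p) = 2 := by rw [one_div, rpow_rpow_inv zero_le_two hp0.ne']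
    rw [show τ / 2 ^ p / R ^ ((n : ℝ) + κ) * ∫ z in cyl n R κ, |u z| ^ p
      = (τ / R ^ ((n : ℝ) + κ) * ∫ z in cyl n R κ, |u z| ^ p) / 2 ^ p by ring,
      div_rpow (by positivity) (by positivity), h2]
  rw [harg]
  set G₁ := ∫ ζ in Ioi (y R / 2), tailWeight f (k : ℝ)⁻¹ (k : ℝ)⁻¹ ζ with hG₁
  set G₂ := ∫ ζ in Ioi (y R / 2), tailWeight f (p / m) (m : ℝ)⁻¹ ζ with hG₂
  have hF : Fkappa k m p κ f (y R / 2) = G₁ ^ κ⁻¹ + G₂ := rfl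
  have hG₁0 : 0 ≤ G₁ := setIntegral_nonneg measurableSet_Ioi fun ζ hζ =>
    tailWeight_nonneg hf.2.2.2.2 ((half_pos hy0).trans hζ)
  have hG₂0 : 0 ≤ G₂ := setIntegral_nonneg measurableSet_Ioi fun ζ hζ =>
    tailWeight_nonneg hf.2.2.2.2 ((half_pos hy0).trans hζ)
  rw [hF]
  rcases le_total (R / 2) (C₂ * G₂) with h | h
  · have h1 : 1 / (2 * C₂) * R ≤ G₂ := by
      rw [div_mul_eq_mul_div, div_le_iff₀ (by positivity)]
      linarith
    calc _ ≤ 1 / (2 * C₂) * R := mul_le_mul_of_nonneg_right (min_le_right _ _) hR.le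
      _ ≤ G₂ := h1
      _ ≤ _ := le_add_of_nonneg_left (rpow_nonneg hG₁0 _)
  · have h1 : R / 2 ≤ C₁ / (κ * R ^ κ / (2 * R)) * G₁ := by linarith
    have h2 : κ / (4 * C₁) * R ^ κ ≤ G₁ := by
      have hRκ : 0 < R ^ κ := rpow_pos_of_pos hR κ
      rw [div_div_eq_mul_div, div_mul_eq_mul_div, le_div_iff₀ (by positivity)] at h1
      rw [div_mul_eq_mul_div, div_le_iff₀ (by positivity)]
      nlinarith
    have h3 := rpow_le_rpow (by positivity) h2 (inv_nonneg.2 hκ.le)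
    rw [mul_rpow (by positivity) (by positivity), rpow_rpow_inv hR.le hκ.ne'] at h3
    calc _ ≤ (κ / (4 * C₁)) ^ κ⁻¹ * R := mul_le_mul_of_nonneg_right (min_le_left _ _) hR.le
      _ ≤ G₁ ^ κ⁻¹ := h3
      _ ≤ _ := le_add_of_nonneg_right hG₂0
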